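/- arXiv:2604.12953 — 3 statements merged into one kernel-verified Lean document; each statement's English description precedes it below -/
import Mathlib

section
/- For every integer k, every complex number z, every noise level σ > 0, and every quantizer index l ∈ {0,1,2,3}, the 1-bit I/Q channel law satisfies W_σ(y_{(l+k) mod 4}, z) = W_σ(y_l, z·e^{-iπk/2}); that is, shifting the quantizer output index by k (mod 4) is equivalent to rotating the noiseless channel input by the phase −πk/2. -/
open MeasureTheory ProbabilityTheory

/-- Standard Gaussian tail function. -/
noncomputable def Qtail (x : ℝ) : ℝ := ((gaussianReal 0 1) (Set.Ioi x)).toReal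

/-- 1-bit quantizer output points `y_l = i^l * (1 + i)`. -/
noncomputable def ypt (l : ℕ) : ℂ := Complex.I ^ l * (1 + Complex.I)

/-- 1-bit I/Q channel law. -/
noncomputable def Wlaw (σ : ℝ) (l : ℕ) (z : ℂ) : ℝ :=
  Qtail (-(z.re * (ypt l).re) / (σ / Real.sqrt 2)) *
  Qtail (-(z.im * (ypt l).im) / (σ / Real.sqrt 2))

/-- `ξ x = -x * log₂ x` (with `ξ 0 = 0`). -/
noncomputable def xi (x : ℝ) : ℝ := -x * Real.logb 2 x

/-- Binary entropy function in bits. -/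
noncomputable def Hb (p : ℝ) : ℝ := xi p + xi (1 - p)

/-- Standard circularly-symmetric complex Gaussian measure on ℂ. -/
noncomputable def muH : Measure ℂ :=
  Measure.map (fun p : ℝ × ℝ => (p.1 : ℂ) + (p.2 : ℂ) * Complex.I)
    ((gaussianReal 0 (1/2)).prod (gaussianReal 0 (1/2)))

theorem stmt0 (k : ℤ) (z : ℂ) (σ : ℝ) (hσ : 0 < σ) (l : ℕ) (hl : l < 4) :
    Wlaw σ (((l : ℤ) + k) % 4).toNat z
      = Wlaw σ l (z * Complex.exp (-(Real.pi * k / 2) * Complex.I)) := by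
  obtain ⟨q, r, hr, rfl⟩ : ∃ (q : ℤ) (r : ℕ), r < 4 ∧ k = 4 * q + r :=
    ⟨k / 4, (k % 4).toNat, by omega, by omega⟩
  have hexp : Complex.exp (-(Real.pi * ((4 * q + r : ℤ) : ℂ) / 2) * Complex.I)
      = (-Complex.I) ^ r := by
    have h1 : (-(Real.pi * ((4 * q + r : ℤ) : ℂ) / 2) * Complex.I)
        = (r : ℂ) * (-(Real.pi / 2 * Complex.I)) + ((-q : ℤ) : ℂ) * (2 * Real.pi * Complex.I) := by
      push_cast; ring
    rw [h1, Complex.exp_add, Complex.exp_int_mul_two_pi_mul_I, mul_one, Complex.exp_nat_mul,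
      Complex.exp_neg, Complex.exp_pi_div_two_mul_I, Complex.inv_I]
  rw [hexp]
  have hm : (((l : ℤ) + (4 * q + r)) % 4).toNat = (l + r) % 4 := by omega
  rw [hm]
  clear hexp hm
  interval_cases l <;> interval_cases r <;>
    simp [Wlaw, ypt, pow_succ, mul_comm]
end

section
/- Let μ be a π/2-symmetric probability measure on ℂ. Then for every fixed channel coefficient h ∈ ℂ, every σ > 0, and every quantizer index l ∈ {0,1,2,3}, the output probability mass of the 1-bit I/Q channel is uniform: ∫_ℂ W_σ(y_l, h·x) dμ(x) = 1/4. Consequently the output entropy of the 1-bit channel under a π/2-symmetric input equals 2 bits. -/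
open MeasureTheory ProbabilityTheory

lemma Qtail_antitone : Antitone Qtail := by
  intro a b hab
  unfold Qtail
  exact ENNReal.toReal_mono (measure_ne_top _ _) (measure_mono (Set.Ioi_subset_Ioi hab))

lemma Qtail_nonneg (x : ℝ) : 0 ≤ Qtail x := ENNReal.toReal_nonneg

lemma Qtail_le_one (x : ℝ) : Qtail x ≤ 1 := by
  unfold Qtail
  exact ENNReal.toReal_le_of_le_ofReal zero_le_one (by simpa using prob_le_one)

lemma Qtail_add_neg (x : ℝ) : Qtail x + Qtail (-x) = 1 := by
  have hmap : (gaussianReal 0 1).map (fun y : ℝ => -y) = gaussianReal 0 1 := by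
    rw [gaussianReal_map_neg]; simp
  haveI hns : NullSingletonClass (gaussianReal 0 1) := nullSingletonClass_gaussianReal one_ne_zero
  have h1 : gaussianReal 0 1 (Set.Ioi (-x)) = gaussianReal 0 1 (Set.Iic x) := by
    rw [← hmap, Measure.map_apply measurable_neg measurableSet_Ioi, hmap]
    have : (fun y : ℝ => -y) ⁻¹' Set.Ioi (-x) = Set.Iio x := by
      ext y; simp
    rw [this]
    exact measure_congr Iio_ae_eq_Iic
  have h2 := prob_add_prob_compl (μ := gaussianReal 0 1) (s := Set.Ioi x) measurableSet_Ioi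
  rw [Set.compl_Ioi] at h2
  unfold Qtail
  rw [h1, ← ENNReal.toReal_add (measure_ne_top _ _) (measure_ne_top _ _), h2]
  simp

lemma Wlaw_rot (σ : ℝ) (l : ℕ) (z : ℂ) : Wlaw σ (l + 1) (Complex.I * z) = Wlaw σ l z := by
  have : ypt (l + 1) = Complex.I * ypt l := by unfold ypt; ring
  unfold Wlaw
  rw [this, mul_comm]
  simp

lemma Wlaw_measurable (σ : ℝ) (l : ℕ) (h : ℂ) : Measurable (fun x => Wlaw σ l (h * x)) := by
  have hQ := Qtail_antitone.measurable
  unfold Wlaw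
  refine (hQ.comp ?_).mul (hQ.comp ?_)
  · exact ((Complex.measurable_re.comp (measurable_const_mul h)).mul_const _).neg.div_const _
  · exact ((Complex.measurable_im.comp (measurable_const_mul h)).mul_const _).neg.div_const _

lemma Wlaw_integrable (μ : Measure ℂ) [IsProbabilityMeasure μ] (σ : ℝ) (l : ℕ) (h : ℂ) :
    Integrable (fun x => Wlaw σ l (h * x)) μ := by
  refine Integrable.of_bound (Wlaw_measurable σ l h).aestronglyMeasurable 1
    (Filter.Eventually.of_forall fun x => ?_)
  unfold Wlaw
  rw [Real.norm_of_nonneg (mul_nonneg (Qtail_nonneg _) (Qtail_nonneg _))]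
  exact mul_le_one₀ (Qtail_le_one _) (Qtail_nonneg _) (Qtail_le_one _)

lemma Wlaw_sum (σ : ℝ) (z : ℂ) :
    Wlaw σ 0 z + Wlaw σ 1 z + Wlaw σ 2 z + Wlaw σ 3 z = 1 := by
  have a := Qtail_add_neg (z.re / (σ / Real.sqrt 2))
  have b := Qtail_add_neg (z.im / (σ / Real.sqrt 2))
  simp only [Wlaw, ypt, pow_succ, pow_zero, one_mul, Complex.I_mul_I, Complex.mul_re,
    Complex.mul_im, Complex.add_re, Complex.add_im, Complex.one_re, Complex.one_im,
    Complex.I_re, Complex.I_im, Complex.neg_re, Complex.neg_im]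
  norm_num [neg_div]
  linear_combination (Qtail (z.im / (σ / Real.sqrt 2)) + Qtail (-(z.im / (σ / Real.sqrt 2)))) * a + b

theorem stmt5 (μ : Measure ℂ) [IsProbabilityMeasure μ]
    (hsym : Measure.map (fun x : ℂ => Complex.I * x) μ = μ)
    (h : ℂ) (σ : ℝ) (hσ : 0 < σ) :
    (∀ l < 4, ∫ x, Wlaw σ l (h * x) ∂μ = 1 / 4)
      ∧ ∑ l ∈ Finset.range 4, xi (∫ x, Wlaw σ l (h * x) ∂μ) = 2 := by
  have hstep : ∀ l, ∫ x, Wlaw σ (l + 1) (h * x) ∂μ = ∫ x, Wlaw σ l (h * x) ∂μ := by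
    intro l
    conv_lhs => rw [← hsym]
    rw [integral_map (measurable_const_mul _).aemeasurable
      (Wlaw_measurable σ (l + 1) h).aestronglyMeasurable]
    refine integral_congr_ae (Filter.Eventually.of_forall fun x => ?_)
    simp only
    rw [mul_left_comm, Wlaw_rot]
  have h0 : ∀ l, ∫ x, Wlaw σ l (h * x) ∂μ = ∫ x, Wlaw σ 0 (h * x) ∂μ := by
    intro l
    induction l with
    | zero => rfl
    | succ k ih => rw [hstep, ih]
  have hs : ∫ x, (Wlaw σ 0 (h * x) + Wlaw σ 1 (h * x) + Wlaw σ 2 (h * x) + Wlaw σ 3 (h * x)) ∂μ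
      = 1 := by
    simp [Wlaw_sum]
  have i := fun l => Wlaw_integrable μ σ l h
  have i01 : Integrable (fun x => Wlaw σ 0 (h * x) + Wlaw σ 1 (h * x)) μ := (i 0).add (i 1)
  have i012 : Integrable (fun x => Wlaw σ 0 (h * x) + Wlaw σ 1 (h * x) + Wlaw σ 2 (h * x)) μ :=
    i01.add (i 2)
  rw [integral_add i012 (i 3), integral_add i01 (i 2),
    integral_add (i 0) (i 1), h0 1, h0 2, h0 3] at hs
  have hq : ∀ l, ∫ x, Wlaw σ l (h * x) ∂μ = 1 / 4 := by
    intro l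
    rw [h0 l]; linarith
  refine ⟨fun l _ => hq l, ?_⟩
  have hl : Real.logb 2 (1 / 4) = -2 := by
    rw [show (1 / 4 : ℝ) = 2 ^ (-2 : ℝ) by
      rw [Real.rpow_neg (by norm_num)]; norm_num]
    exact Real.logb_rpow (by norm_num) (by norm_num)
  simp only [hq, xi, hl]
  norm_num
end

section
/- Let σ > 0 and P > 0, and let μ_H be the standard circularly-symmetric complex Gaussian measure on ℂ. Then for every x ∈ ℂ with |x|² ≤ P, the fading-averaged conditional output entropy of the 1-bit I/Q channel satisfies ∫_ℂ ∑_{l=0}^{3} ξ(W_σ(y_l, h·x)) dμ_H(h) ≥ ∫_ℂ ∑_{l=0}^{3} ξ(W_σ(y_l, h·√P)) dμ_H(h); i.e., the fading-averaged conditional entropy depends only on |x| and is minimized over the power ball at full amplitude √P. -/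
open MeasureTheory ProbabilityTheory

lemma Qtail_neg (x : ℝ) : Qtail (-x) = 1 - Qtail x := by
  have h1 : (gaussianReal 0 1) (Set.Ioi (-x)) = (gaussianReal 0 1) (Set.Iic x) := by
    have h := gaussianReal_map_neg (μ := 0) (v := 1)
    rw [neg_zero] at h
    have : NullSingletonClass (gaussianReal 0 1) := nullSingletonClass_gaussianReal one_ne_zero
    conv_lhs => rw [← h]
    rw [Measure.map_apply measurable_neg measurableSet_Ioi]
    have : (fun x : ℝ => -x) ⁻¹' Set.Ioi (-x) = Set.Iio x := by
      ext y; simp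
    rw [this]
    exact measure_congr Iio_ae_eq_Iic
  have h2 : (Set.Iic x) = (Set.Ioi x)ᶜ := by simp
  unfold Qtail
  rw [h1, h2]
  exact probReal_compl_eq_one_sub measurableSet_Ioi

lemma Qtail_le_half {x : ℝ} (h : 0 ≤ x) : Qtail x ≤ 2⁻¹ := by
  have h0 := Qtail_neg 0
  rw [neg_zero] at h0
  have := Qtail_antitone h
  linarith

lemma Hb_eq (p : ℝ) : Hb p = Real.binEntropy p / Real.log 2 := by
  unfold Hb xi
  rw [Real.binEntropy_eq_negMulLog_add_negMulLog_one_sub]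
  simp only [Real.negMulLog, Real.logb]
  ring

lemma Hb_symm (p : ℝ) : Hb (1 - p) = Hb p := by
  rw [Hb_eq, Hb_eq, Real.binEntropy_one_sub]

lemma xi_mul (p q : ℝ) : xi (p * q) = p * xi q + q * xi p := by
  unfold xi
  rcases eq_or_ne p 0 with rfl | hp
  · simp
  rcases eq_or_ne q 0 with rfl | hq
  · simp
  rw [Real.logb_mul hp hq]; ring

noncomputable def gfun (σ t : ℝ) : ℝ := Hb (Qtail (t / (σ / Real.sqrt 2)))

lemma sum_eq (σ : ℝ) (z : ℂ) :
    ∑ l ∈ Finset.range 4, xi (Wlaw σ l z) = gfun σ z.re + gfun σ z.im := by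
  have e0 : ypt 0 = ⟨1, 1⟩ := by apply Complex.ext <;> simp [ypt]
  have e1 : ypt 1 = ⟨-1, 1⟩ := by apply Complex.ext <;> simp [ypt]
  have e2 : ypt 2 = ⟨-1, -1⟩ := by apply Complex.ext <;> simp [ypt]
  have e3 : ypt 3 = ⟨1, -1⟩ := by apply Complex.ext <;> simp [ypt, pow_succ]
  simp only [Finset.sum_range_succ, Finset.sum_range_zero, Wlaw, e0, e1, e2, e3, gfun, mul_one,
    mul_neg, neg_neg, neg_div, Qtail_neg, xi_mul, Hb]
  ring

lemma gfun_even (σ t : ℝ) : gfun σ |t| = gfun σ t := by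
  rcases abs_choice t with h | h <;> rw [h]
  rw [gfun, neg_div, Qtail_neg, Hb_symm, gfun]

lemma gfun_anti {σ : ℝ} (hσ : 0 < σ) {s t : ℝ} (h : |s| ≤ |t|) : gfun σ t ≤ gfun σ s := by
  rw [← gfun_even σ t, ← gfun_even σ s]
  unfold gfun
  have hd : 0 < σ / Real.sqrt 2 := by positivity
  rw [Hb_eq, Hb_eq]
  have hl : 0 < Real.log 2 := Real.log_pos (by norm_num)
  apply div_le_div_of_nonneg_right _ hl.le
  apply Real.binEntropy_strictMonoOn.monotoneOn
  · exact ⟨Qtail_nonneg _, Qtail_le_half (by positivity)⟩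
  · exact ⟨Qtail_nonneg _, Qtail_le_half (by positivity)⟩
  · apply Qtail_antitone
    gcongr

lemma gfun_meas (σ : ℝ) : Measurable (gfun σ) := by
  have h1 : Measurable Qtail := Qtail_antitone.measurable
  have h2 : Measurable Hb := by
    have : Hb = fun p => Real.binEntropy p / Real.log 2 := funext Hb_eq
    rw [this]
    exact Real.binEntropy_continuous.measurable.div_const _
  exact h2.comp (h1.comp (measurable_id.div_const _))

lemma gfun_nonneg (σ t : ℝ) : 0 ≤ gfun σ t := by
  rw [gfun, Hb_eq]
  exact div_nonneg (Real.binEntropy_nonneg (Qtail_nonneg _) (Qtail_le_one _))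
    (Real.log_nonneg (by norm_num))

lemma gfun_le (σ t : ℝ) : gfun σ t ≤ 1 := by
  rw [gfun, Hb_eq, div_le_one (Real.log_pos (by norm_num))]
  exact Real.binEntropy_le_log_two

lemma gfun_int {α : Type*} [MeasurableSpace α] (μ : Measure α) [IsProbabilityMeasure μ] (σ : ℝ)
    {f : α → ℝ} (hf : Measurable f) : Integrable (fun a => gfun σ (f a)) μ := by
  refine Integrable.of_bound ((gfun_meas σ).comp hf).aestronglyMeasurable 1 (ae_of_all _ ?_)
  intro a
  rw [Real.norm_eq_abs, abs_of_nonneg (gfun_nonneg _ _)]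
  exact gfun_le _ _

lemma map_lin (a b r : ℝ) (h : r ^ 2 = a ^ 2 + b ^ 2) :
    Measure.map (fun p : ℝ × ℝ => a * p.1 + b * p.2)
      ((gaussianReal 0 (1/2)).prod (gaussianReal 0 (1/2)))
    = Measure.map (fun t => r * t) (gaussianReal 0 (1/2)) := by
  have e : (fun p : ℝ × ℝ => a * p.1 + b * p.2)
      = (fun p : ℝ × ℝ => p.1 + p.2) ∘ Prod.map (fun t => a * t) (fun t => b * t) := rfl
  rw [e, ← Measure.map_map (by fun_prop) (by fun_prop),
    ← Measure.map_prod_map _ _ (by fun_prop) (by fun_prop), gaussianReal_map_const_mul,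
    gaussianReal_map_const_mul, gaussianReal_map_const_mul]
  have := gaussianReal_conv_gaussianReal (m₁ := a * 0) (m₂ := b * 0)
    (v₁ := .mk (a ^ 2) (sq_nonneg _) * (1/2)) (v₂ := .mk (b ^ 2) (sq_nonneg _) * (1/2))
  rw [Measure.conv] at this
  rw [this]
  congr 1
  · ring
  · rw [← add_mul]
    congr 1
    exact NNReal.eq h.symm

lemma int_lin (σ a b r : ℝ) (h : r ^ 2 = a ^ 2 + b ^ 2) :
    ∫ p : ℝ × ℝ, gfun σ (a * p.1 + b * p.2)
      ∂((gaussianReal 0 (1/2)).prod (gaussianReal 0 (1/2)))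
    = ∫ t, gfun σ (r * t) ∂(gaussianReal 0 (1/2)) := by
  have h1 := integral_map (μ := (gaussianReal 0 (1/2)).prod (gaussianReal 0 (1/2)))
    (φ := fun p : ℝ × ℝ => a * p.1 + b * p.2) (by fun_prop)
    (gfun_meas σ).aestronglyMeasurable
  have h2 := integral_map (μ := gaussianReal 0 (1/2))
    (φ := fun t : ℝ => r * t) (by fun_prop) (gfun_meas σ).aestronglyMeasurable
  rw [← h1, ← h2, map_lin a b r h]

lemma int_eq (σ : ℝ) (x : ℂ) :
    ∫ h, ∑ l ∈ Finset.range 4, xi (Wlaw σ l (h * x)) ∂muH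
      = 2 * ∫ t, gfun σ (‖x‖ * t) ∂(gaussianReal 0 (1/2)) := by
  simp only [sum_eq]
  have hm : Measurable (fun h : ℂ => gfun σ (h * x).re + gfun σ (h * x).im) :=
    ((gfun_meas σ).comp (by fun_prop)).add ((gfun_meas σ).comp (by fun_prop))
  rw [muH, integral_map (by fun_prop) hm.aestronglyMeasurable]
  have hn : ‖x‖ ^ 2 = x.re ^ 2 + x.im ^ 2 := by
    rw [Complex.sq_norm, Complex.normSq_apply]; ring
  have e1 : ∀ p : ℝ × ℝ, (((p.1 : ℂ) + (p.2 : ℂ) * Complex.I) * x).re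
      = x.re * p.1 + (-x.im) * p.2 := by intro p; simp; ring
  have e2 : ∀ p : ℝ × ℝ, (((p.1 : ℂ) + (p.2 : ℂ) * Complex.I) * x).im
      = x.im * p.1 + x.re * p.2 := by intro p; simp; ring
  simp only [e1, e2]
  rw [integral_add (gfun_int _ _ (by fun_prop)) (gfun_int _ _ (by fun_prop)),
    int_lin σ _ _ ‖x‖ (by rw [hn]; ring), int_lin σ _ _ ‖x‖ (by rw [hn]; ring)]
  ring

theorem stmt10 (σ P : ℝ) (hσ : 0 < σ) (hP : 0 < P)
    (x : ℂ) (hx : ‖x‖ ^ 2 ≤ P) :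
    ∫ h, ∑ l ∈ Finset.range 4, xi (Wlaw σ l (h * x)) ∂muH
      ≥ ∫ h, ∑ l ∈ Finset.range 4, xi (Wlaw σ l (h * (Real.sqrt P : ℂ))) ∂muH := by
  rw [int_eq, int_eq, ge_iff_le]
  apply mul_le_mul_of_nonneg_left _ (by norm_num)
  apply integral_mono (gfun_int _ _ (by fun_prop)) (gfun_int _ _ (by fun_prop))
  intro t
  apply gfun_anti hσ
  rw [abs_mul, abs_mul]
  have h1 : ‖x‖ ≤ Real.sqrt P := Real.le_sqrt_of_sq_le hx
  have h2 : ‖(Real.sqrt P : ℂ)‖ = Real.sqrt P := by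
    rw [Complex.norm_real, Real.norm_of_nonneg (Real.sqrt_nonneg _)]
  rw [h2, abs_of_nonneg (norm_nonneg _), abs_of_nonneg (Real.sqrt_nonneg _)]
  gcongr
end
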